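/- (Mutual dependence upper bound.) For every A ⊆ M with |A| ≥ 2, the smallest rate of communication for omniscience satisfies R_CO(A) ≥ h(M) − I(A); equivalently, the secret-key capacity C_SK(A) := h(M) − R_CO(A) satisfies C_SK(A) ≤ I(A). -/

import Mathlib

open Finset

/-- Marginal pmf of `p` on the coordinates in `S`. -/
noncomputable def marg {m : ℕ} {𝒳 : Fin m → Type} [∀ i, Fintype (𝒳 i)]
    [∀ i, DecidableEq (𝒳 i)] (p : (∀ i, 𝒳 i) → ℝ) (S : Finset (Fin m))
    (y : ∀ i : {j // j ∈ S}, 𝒳 i.1) : ℝ :=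
  ∑ x : ∀ i, 𝒳 i, if ∀ i : {j // j ∈ S}, x i.1 = y i then p x else 0

/-- Shannon entropy (base 2) of the coordinates in `S`. -/
noncomputable def Hent {m : ℕ} {𝒳 : Fin m → Type} [∀ i, Fintype (𝒳 i)]
    [∀ i, DecidableEq (𝒳 i)] (p : (∀ i, 𝒳 i) → ℝ) (S : Finset (Fin m)) : ℝ :=
  -∑ y : ∀ i : {j // j ∈ S}, 𝒳 i.1, marg p S y * Real.logb 2 (marg p S y)

/-- The conditional entropy function `h(B) = H(X_M) - H(X_{Bᶜ}) = H(X_B | X_{Bᶜ})`. -/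
noncomputable def condh {m : ℕ} {𝒳 : Fin m → Type} [∀ i, Fintype (𝒳 i)]
    [∀ i, DecidableEq (𝒳 i)] (p : (∀ i, 𝒳 i) → ℝ) (B : Finset (Fin m)) : ℝ :=
  Hent p Finset.univ - Hent p Bᶜ

/-- Conditional entropy `H(X_S | X_U) = H(X_{S ∪ U}) - H(X_U)`. -/
noncomputable def condEnt {m : ℕ} {𝒳 : Fin m → Type} [∀ i, Fintype (𝒳 i)]
    [∀ i, DecidableEq (𝒳 i)] (p : (∀ i, 𝒳 i) → ℝ) (S U : Finset (Fin m)) : ℝ :=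
  Hent p (S ∪ U) - Hent p U

/-- `B ∈ ℬ(A)`: `B` is a nonempty proper subset of `M` not containing `A`. -/
def memB {m : ℕ} (A B : Finset (Fin m)) : Prop :=
  B.Nonempty ∧ B ⊂ Finset.univ ∧ ¬ A ⊆ B

/-- `R ∈ ℛ(A)`: the rate tuple `R` satisfies all Slepian–Wolf constraints for `A`. -/
def feasible {m : ℕ} {𝒳 : Fin m → Type} [∀ i, Fintype (𝒳 i)]
    [∀ i, DecidableEq (𝒳 i)] (p : (∀ i, 𝒳 i) → ℝ) (A : Finset (Fin m))
    (R : Fin m → ℝ) : Prop :=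
  ∀ B : Finset (Fin m), memB A B → condh p B ≤ ∑ j ∈ B, R j

/-- Smallest rate of communication for omniscience `R_CO(A)`. -/
noncomputable def RCO {m : ℕ} {𝒳 : Fin m → Type} [∀ i, Fintype (𝒳 i)]
    [∀ i, DecidableEq (𝒳 i)] (p : (∀ i, 𝒳 i) → ℝ) (A : Finset (Fin m)) : ℝ :=
  sInf {s : ℝ | ∃ R : Fin m → ℝ, feasible p A R ∧ s = ∑ j, R j}

/-- `(C 1, …, C k)` is a partition of `M` into pairwise disjoint sets. -/
def isPartition {m k : ℕ} (C : Fin k → Finset (Fin m)) : Prop :=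
  (∀ i j, i ≠ j → Disjoint (C i) (C j)) ∧ Finset.univ.biUnion C = Finset.univ

/-- Mutual dependence `I(C_1,…,C_k)` of the partitioning `C`. -/
noncomputable def Ival {m : ℕ} {𝒳 : Fin m → Type} [∀ i, Fintype (𝒳 i)]
    [∀ i, DecidableEq (𝒳 i)] (p : (∀ i, 𝒳 i) → ℝ) {k : ℕ}
    (C : Fin k → Finset (Fin m)) : ℝ :=
  ((∑ i, Hent p (C i)) - Hent p Finset.univ) / ((k : ℝ) - 1)

/-- Mutual dependence upper bound `I(A)`: minimum of `I(C_1,…,C_k)` over all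
`2 ≤ k ≤ |A|` and partitionings in `𝒫_k(A)`. -/
noncomputable def IA {m : ℕ} {𝒳 : Fin m → Type} [∀ i, Fintype (𝒳 i)]
    [∀ i, DecidableEq (𝒳 i)] (p : (∀ i, 𝒳 i) → ℝ) (A : Finset (Fin m)) : ℝ :=
  sInf {r : ℝ | ∃ k : ℕ, 2 ≤ k ∧ k ≤ A.card ∧ ∃ C : Fin k → Finset (Fin m),
    isPartition C ∧ (∀ i, (C i ∩ A).Nonempty) ∧ r = Ival p C}

theorem exists_feasible {m : ℕ} {𝒳 : Fin m → Type} [∀ i, Fintype (𝒳 i)]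
    [∀ i, DecidableEq (𝒳 i)] (p : (∀ i, 𝒳 i) → ℝ) (A : Finset (Fin m)) :
    ∃ R : Fin m → ℝ, feasible p A R := by
  refine ⟨fun _ => ∑ B, |condh p B|, fun B hB => ?_⟩
  obtain ⟨j, hj⟩ := hB.1
  have hT : (0 : ℝ) ≤ ∑ B, |condh p B| := sum_nonneg fun _ _ => abs_nonneg _
  calc condh p B ≤ |condh p B| := le_abs_self _
    _ ≤ ∑ B, |condh p B| :=
      single_le_sum (f := fun B => |condh p B|) (fun _ _ => abs_nonneg _) (mem_univ B)
    _ ≤ ∑ _j ∈ B, ∑ B, |condh p B| :=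
      single_le_sum (f := fun _ => ∑ B, |condh p B|) (fun _ _ => hT) hj

/-- If every cell of a partition meets `A`, then the complements of the cells lie in `ℬ(A)`. -/
theorem memB_compl_cell {m k : ℕ} (hk : 2 ≤ k) {A : Finset (Fin m)} {C : Fin k → Finset (Fin m)}
    (hC : isPartition C) (hCA : ∀ i, (C i ∩ A).Nonempty) (i : Fin k) : memB A (C i)ᶜ := by
  obtain ⟨x, hx⟩ := hCA i
  rw [mem_inter] at hx
  have : Nontrivial (Fin k) := Fin.nontrivial_iff_two_le.2 hk
  obtain ⟨j, hj⟩ := exists_ne i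
  obtain ⟨y, hy⟩ := hCA j
  rw [mem_inter] at hy
  refine ⟨⟨y, ?_⟩, ?_, fun h => ?_⟩
  · exact mem_compl.2 (disjoint_left.1 (hC.1 j i hj) hy.1)
  · exact ssubset_univ_iff.2 fun h => mem_compl.1 (h ▸ mem_univ x) hx.1
  · exact mem_compl.1 (h hx.2) hx.1

theorem sub_Ival_le_sum_of_feasible {m : ℕ} {𝒳 : Fin m → Type} [∀ i, Fintype (𝒳 i)]
    [∀ i, DecidableEq (𝒳 i)] (p : (∀ i, 𝒳 i) → ℝ) {k : ℕ} (hk : 2 ≤ k)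
    {A : Finset (Fin m)} {C : Fin k → Finset (Fin m)} (hC : isPartition C)
    (hCA : ∀ i, (C i ∩ A).Nonempty) {R : Fin m → ℝ} (hR : feasible p A R) :
    Hent p Finset.univ - Ival p C ≤ ∑ j, R j := by
  have hsum : ∑ i, ∑ j ∈ C i, R j = ∑ j, R j := by
    rw [← hC.2, sum_biUnion fun i _ j _ hij => hC.1 i j hij]
  have hcell : ∀ i, Hent p Finset.univ - Hent p (C i) ≤ ∑ j, R j - ∑ j ∈ C i, R j := by
    intro i
    have h := hR _ (memB_compl_cell hk hC hCA i)
    rw [condh, compl_compl] at h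
    linarith [sum_add_sum_compl (C i) R]
  have htotal := sum_le_sum fun i (_ : i ∈ Finset.univ) => hcell i
  simp only [sum_sub_distrib, sum_const, card_univ, Fintype.card_fin, nsmul_eq_mul, hsum]
    at htotal
  have hk' : (0 : ℝ) < (k : ℝ) - 1 := by
    have : (2 : ℝ) ≤ k := by exact_mod_cast hk
    linarith
  rw [sub_le_comm, Ival, le_div_iff₀ hk']
  linarith

theorem exists_two_cell_partition {m : ℕ} {A : Finset (Fin m)} (hA : 2 ≤ A.card) :
    ∃ C : Fin 2 → Finset (Fin m), isPartition C ∧ ∀ i, (C i ∩ A).Nonempty := by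
  obtain ⟨a, ha, b, hb, hab⟩ := one_lt_card.1 hA
  refine ⟨![{a}, {a}ᶜ], ⟨?_, ?_⟩, ?_⟩
  · intro i j hij
    fin_cases i <;> fin_cases j <;> simp_all
  · ext x
    simp [Fin.exists_fin_two, em]
  · intro i
    fin_cases i
    · exact ⟨a, by simp [ha]⟩
    · exact ⟨b, by simp [hb, hab.symm]⟩

/-- **Mutual dependence upper bound.** For every `A ⊆ M` with `|A| ≥ 2`,
`R_CO(A) ≥ h(M) − I(A)`, equivalently `C_SK(A) = h(M) − R_CO(A) ≤ I(A)`. -/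
theorem mutual_dependence_upper_bound {m : ℕ} (hm : 2 ≤ m) {𝒳 : Fin m → Type}
    [∀ i, Fintype (𝒳 i)] [∀ i, DecidableEq (𝒳 i)] [∀ i, Nonempty (𝒳 i)]
    (p : (∀ i, 𝒳 i) → ℝ) (hp0 : ∀ x, 0 ≤ p x) (hp1 : ∑ x, p x = 1)
    (A : Finset (Fin m)) (hA : 2 ≤ A.card) :
    Hent p Finset.univ - IA p A ≤ RCO p A := by
  rw [sub_le_comm]
  refine le_csInf ?_ ?_
  · obtain ⟨C, hC, hCA⟩ := exists_two_cell_partition hA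
    exact ⟨_, 2, le_rfl, hA, C, hC, hCA, rfl⟩
  · rintro r ⟨k, hk, -, C, hC, hCA, rfl⟩
    rw [sub_le_comm]
    refine le_csInf ?_ ?_
    · obtain ⟨R, hR⟩ := exists_feasible p A
      exact ⟨_, R, hR, rfl⟩
    · rintro s ⟨R, hR, rfl⟩
      exact sub_Ival_le_sum_of_feasible p hk hC hCA hR
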